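/- arXiv:1508.03461 — 4 statements merged into one kernel-verified Lean document; each statement's English description precedes it below -/
import Mathlib

section
/- (No-arbitrage pricing in the one-period binomial model) Consider a one-period market with: a riskless asset (cash at zero interest), a stock with present price S > 0 whose terminal price is uS in the up state and dS in the down state, where u > 1 > d > 0, and an option with present price C whose terminal payoff is C_u in the up state and C_d in the down state. A portfolio is a triple (k_0, k_S, k_C) ∈ ℝ³ with initial value k_0 + k_S·S + k_C·C and terminal value k_0 + k_S·uS + k_C·C_u in the up state and k_0 + k_S·dS + k_C·C_d in the down state. An arbitrage is a portfolio with zero initial value, both terminal values nonnegative, and at least one terminal value strictly positive. Then the market admits no arbitrage if and only if C = p̃·C_u + (1 − p̃)·C_d, where p̃ = (1 − d)/(u − d). -/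
/-- **No-arbitrage pricing in the one-period binomial model.** With a riskless asset at
zero interest, a stock of present price `S` with terminal prices `u·S` (up) and `d·S`
(down), `u > 1 > d > 0`, and an option of present price `C` with terminal payoffs `Cu`
(up) and `Cd` (down), the market admits no arbitrage portfolio if and only if
`C = p̃·Cu + (1 - p̃)·Cd` where `p̃ = (1 - d)/(u - d)`. -/
theorem one_period_binomial_no_arbitrage
    (S C Cu Cd u d : ℝ) (hS : 0 < S) (hu : 1 < u) (hd1 : d < 1) (hd0 : 0 < d) :
    (¬ ∃ k0 kS kC : ℝ,
        k0 + kS * S + kC * C = 0 ∧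
        0 ≤ k0 + kS * (u * S) + kC * Cu ∧
        0 ≤ k0 + kS * (d * S) + kC * Cd ∧
        (0 < k0 + kS * (u * S) + kC * Cu ∨ 0 < k0 + kS * (d * S) + kC * Cd)) ↔
      C = (1 - d) / (u - d) * Cu + (1 - (1 - d) / (u - d)) * Cd := by
  have hud : 0 < u - d := by linarith
  have hp0 : 0 < (1 - d) / (u - d) := div_pos (by linarith) hud
  have hp1 : (1 - d) / (u - d) < 1 := (div_lt_one hud).2 (by linarith)
  have hmean : (1 - d) / (u - d) * (u - d) = 1 - d := div_mul_cancel₀ _ hud.ne'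
  generalize (1 - d) / (u - d) = p at *
  constructor
  · intro hna
    by_contra hne
    have hgain : 0 < (p * Cu + (1 - p) * Cd - C) ^ 2 :=
      sq_pos_iff.2 (sub_ne_zero.2 (Ne.symm hne))
    obtain ⟨r, hr⟩ : ∃ r, r * S * (u - d) = Cu - Cd :=
      ⟨(Cu - Cd) / (S * (u - d)), by field_simp⟩
    set e := p * Cu + (1 - p) * Cd - C with he
    have hup : e * (r * S - C) + -(e * r) * (u * S) + e * Cu = e ^ 2 := by
      linear_combination e * (p - 1) * hr - e * r * S * hmean - e * he
    have hdown : e * (r * S - C) + -(e * r) * (d * S) + e * Cd = e ^ 2 := by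
      linear_combination e * p * hr - e * r * S * hmean - e * he
    refine hna ⟨e * (r * S - C), -(e * r), e, by ring, ?_, ?_, Or.inl ?_⟩
    · exact hup ▸ hgain.le
    · exact hdown ▸ hgain.le
    · exact hup ▸ hgain
  · rintro hC ⟨k0, kS, kC, h0, hup, hdown, hpos⟩
    have hvalue : p * (k0 + kS * (u * S) + kC * Cu)
        + (1 - p) * (k0 + kS * (d * S) + kC * Cd) = 0 := by
      linear_combination h0 + kS * S * hmean - kC * hC
    have hq0 : 0 < 1 - p := sub_pos.2 hp1
    rcases hpos with hpos | hpos
    · linarith [mul_pos hp0 hpos, mul_nonneg hq0.le hdown]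
    · linarith [mul_nonneg hp0.le hup, mul_pos hq0 hpos]
end

section
/- For every n ≥ 1 there exists a tournament on n vertices (an orientation of the complete graph: for every pair of distinct vertices x, y exactly one of the edges (x, y), (y, x) is present, and there are no loops) whose number of Hamiltonian paths — permutations (x_1, …, x_n) of the vertices such that the edge (x_i, x_{i+1}) is present for every i = 1, …, n−1 — is at least n!/2^{n−1}. -/
/-- The tournament on `Fin n` read off from the values of `f` at the pairs `(x, y)` with `x < y`. -/
def tournamentOfBool {n : ℕ} (f : Fin n × Fin n → Bool) (x y : Fin n) : Bool :=
  if x < y then f (x, y) else if y < x then !f (y, x) else false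

/-- A permutation is a Hamiltonian path in at least a `2 ^ (-m)` fraction of the tournaments on
`m + 1` vertices. -/
theorem two_pow_le_card_isHamiltonianPath_mul {m : ℕ} (σ : Equiv.Perm (Fin (m + 1))) :
    2 ^ Fintype.card (Fin (m + 1) × Fin (m + 1)) ≤
      (Finset.univ.filter (fun f : Fin (m + 1) × Fin (m + 1) → Bool =>
        ∀ i j : Fin (m + 1), (j : ℕ) = (i : ℕ) + 1 →
          tournamentOfBool f (σ i) (σ j) = true)).card * 2 ^ m := by
  classical
  let P : Finset (Fin (m + 1) × Fin (m + 1)) := Finset.univ.image fun i : Fin m =>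
    (min (σ i.castSucc) (σ i.succ), max (σ i.castSucc) (σ i.succ))
  let t : Fin (m + 1) × Fin (m + 1) → Finset Bool := fun p =>
    if p ∈ P then {decide (σ.symm p.1 < σ.symm p.2)} else Finset.univ
  have hP : P.card ≤ m := Finset.card_image_le.trans (by simp)
  have hsub : Fintype.piFinset t ⊆ Finset.univ.filter
      (fun f : Fin (m + 1) × Fin (m + 1) → Bool =>
        ∀ i j : Fin (m + 1), (j : ℕ) = (i : ℕ) + 1 →
          tournamentOfBool f (σ i) (σ j) = true) := by
    intro f hf
    rw [Fintype.mem_piFinset] at hf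
    simp only [Finset.mem_filter, Finset.mem_univ, true_and]
    intro i j hij
    have hlt : i < j := by rw [Fin.lt_def]; omega
    have hmem : (min (σ i) (σ j), max (σ i) (σ j)) ∈ P := by
      refine Finset.mem_image.2 ⟨⟨i, by omega⟩, Finset.mem_univ _, ?_⟩
      have h₁ : (⟨i, by omega⟩ : Fin m).castSucc = i := rfl
      have h₂ : (⟨i, by omega⟩ : Fin m).succ = j := Fin.ext (by simp [hij])
      rw [h₁, h₂]
    have hval := hf (min (σ i) (σ j), max (σ i) (σ j))
    simp only [t, if_pos hmem, Finset.mem_singleton] at hval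
    rcases lt_or_gt_of_ne (σ.injective.ne hlt.ne) with h | h
    · rw [min_eq_left h.le, max_eq_right h.le] at hval
      simp [tournamentOfBool, h, hval, hlt]
    · rw [min_eq_right h.le, max_eq_left h.le] at hval
      simp [tournamentOfBool, h, h.not_gt, hval, hlt.le]
  calc 2 ^ Fintype.card (Fin (m + 1) × Fin (m + 1))
      = ∏ _p : Fin (m + 1) × Fin (m + 1), 2 := by simp
    _ = ∏ p, (t p).card * (if p ∈ P then 2 else 1) := by
        refine Finset.prod_congr rfl fun p _ => ?_
        by_cases h : p ∈ P <;> simp [t, h]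
    _ = (Fintype.piFinset t).card * 2 ^ P.card := by
        rw [Finset.prod_mul_distrib, Fintype.card_piFinset]
        simp
    _ ≤ _ := Nat.mul_le_mul (Finset.card_le_card hsub) (Nat.pow_le_pow_right two_pos hP)

/-- For every `n ≥ 1` there is a tournament on `n` vertices whose number of Hamiltonian
paths (orderings of the vertices, i.e. permutations `σ`, in which each vertex beats its
successor) is at least `n! / 2^{n-1}`. -/
theorem tournament_many_hamiltonian_paths (n : ℕ) (hn : 1 ≤ n) :
    ∃ E : Fin n → Fin n → Bool,
      (∀ x, E x x = false) ∧
      (∀ x y : Fin n, x ≠ y → E x y = !E y x) ∧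
      (n.factorial : ℝ) / 2 ^ (n - 1) ≤
        ((Finset.univ.filter (fun σ : Equiv.Perm (Fin n) =>
            ∀ i j : Fin n, (j : ℕ) = (i : ℕ) + 1 → E (σ i) (σ j) = true)).card : ℝ) := by
  obtain ⟨m, rfl⟩ := Nat.exists_eq_add_of_le' hn
  have hsum : ∑ _f : Fin (m + 1) × Fin (m + 1) → Bool, (m + 1).factorial ≤
      ∑ f : Fin (m + 1) × Fin (m + 1) → Bool,
        (Finset.univ.filter (fun σ : Equiv.Perm (Fin (m + 1)) =>
          ∀ i j : Fin (m + 1), (j : ℕ) = (i : ℕ) + 1 →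
            tournamentOfBool f (σ i) (σ j) = true)).card * 2 ^ m := by
    rw [← Finset.sum_mul]
    have hcount := Finset.sum_card_bipartiteAbove_eq_sum_card_bipartiteBelow
      (s := (Finset.univ : Finset (Fin (m + 1) × Fin (m + 1) → Bool)))
      (t := (Finset.univ : Finset (Equiv.Perm (Fin (m + 1)))))
      (fun f σ => ∀ i j : Fin (m + 1), (j : ℕ) = (i : ℕ) + 1 →
        tournamentOfBool f (σ i) (σ j) = true)
    simp only [Finset.bipartiteAbove, Finset.bipartiteBelow] at hcount
    rw [hcount, Finset.sum_mul]
    refine le_trans (le_of_eq ?_)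
      (Finset.sum_le_sum fun σ _ => two_pow_le_card_isHamiltonianPath_mul σ)
    simp [Fintype.card_perm, mul_comm]
  obtain ⟨f, -, hf⟩ := Finset.exists_le_of_sum_le Finset.univ_nonempty hsum
  refine ⟨tournamentOfBool f, fun x => by simp [tournamentOfBool], fun x y hxy => ?_, ?_⟩
  · rcases lt_or_gt_of_ne hxy with h | h <;> simp [tournamentOfBool, h, h.not_gt]
  · rw [div_le_iff₀ (by positivity), Nat.add_sub_cancel]
    exact_mod_cast hf
end

section
/- (Ramsey lower bound via the probabilistic method) Let n and m ≥ 2 be positive integers such that 2·binomial(n, m)·2^{−binomial(m,2)} < 1. Then there exists a 2-coloring of the edges of the complete graph K_n on n vertices such that no complete subgraph on m vertices is monochromatic (i.e., every m-vertex subset contains edges of both colors). -/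
open Finset in
/-- **Property B.** A family of fewer than `2 ^ (k - 1)` sets of size `k` admits a 2-coloring of the
ground set, given here by one color class, under which no member of the family is monochromatic. -/
theorem exists_finset_not_subset_not_disjoint {α : Type*} [Fintype α] [DecidableEq α]
    {F : Finset (Finset α)} {k : ℕ} (hF : ∀ e ∈ F, #e = k) (h : 2 * #F < 2 ^ k) :
    ∃ A : Finset α, ∀ e ∈ F, ¬ e ⊆ A ∧ ¬ Disjoint A e := by
  by_contra! hA
  have hcover : (univ : Finset (Finset α)) ⊆ F.biUnion fun e ↦ Icc e univ ∪ eᶜ.powerset := by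
    intro A _
    obtain ⟨e, he, hAe⟩ := hA A
    rw [mem_biUnion]
    refine ⟨e, he, ?_⟩
    by_cases heA : e ⊆ A
    · exact mem_union_left _ (mem_Icc.2 ⟨heA, subset_univ A⟩)
    · exact mem_union_right _ (mem_powerset.2 (subset_compl_iff_disjoint_right.2 (hAe heA)))
  obtain ⟨e, he, -⟩ := hA ∅
  have hk : k ≤ Fintype.card α := hF e he ▸ card_le_univ e
  have hbad : ∀ e ∈ F, #(Icc e univ ∪ eᶜ.powerset) ≤ 2 * 2 ^ (Fintype.card α - k) := by
    intro e he
    refine (card_union_le _ _).trans_eq ?_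
    rw [card_Icc_finset (subset_univ e), card_powerset, card_compl, card_univ, hF e he, two_mul]
  have hle := (card_le_card hcover).trans (card_biUnion_le_card_mul _ _ _ hbad)
  rw [card_univ, Fintype.card_finset] at hle
  refine hle.not_gt ?_
  calc #F * (2 * 2 ^ (Fintype.card α - k)) = 2 * #F * 2 ^ (Fintype.card α - k) := by ring
    _ < 2 ^ k * 2 ^ (Fintype.card α - k) := by gcongr
    _ = 2 ^ Fintype.card α := by rw [← pow_add, Nat.add_sub_cancel' hk]

/-- **Ramsey lower bound via the probabilistic method.** If `n, m` are positive integers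
with `m ≥ 2` and `2 · choose n m · 2^{-choose m 2} < 1`, then there exists a symmetric
2-coloring of the edges of the complete graph on `n` vertices in which no set of `m`
vertices is monochromatic: every `m`-vertex subset contains edges of both colors. -/
theorem ramsey_lower_bound (n m : ℕ) (hn : 1 ≤ n) (hm : 2 ≤ m)
    (h : 2 * (n.choose m : ℝ) / 2 ^ (m.choose 2) < 1) :
    ∃ c : Fin n → Fin n → Bool,
      (∀ x y, c x y = c y x) ∧
      ∀ S : Finset (Fin n), S.card = m →
        (∃ x ∈ S, ∃ y ∈ S, x ≠ y ∧ c x y = true) ∧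
        (∃ x ∈ S, ∃ y ∈ S, x ≠ y ∧ c x y = false) := by
  have hlt : 2 * n.choose m < 2 ^ m.choose 2 := by
    rw [div_lt_one (by positivity)] at h
    exact_mod_cast h
  let edges (S : Finset (Fin n)) : Finset (Sym2 (Fin n)) := S.offDiag.image fun p ↦ s(p.1, p.2)
  obtain ⟨A, hA⟩ := exists_finset_not_subset_not_disjoint
    (F := (Finset.univ.powersetCard m).image edges) (k := m.choose 2)
    (by
      intro e he
      obtain ⟨S, hS, rfl⟩ := Finset.mem_image.1 he
      rw [← (Finset.mem_powersetCard.1 hS).2]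
      exact Sym2.card_image_offDiag S)
    (by
      refine lt_of_le_of_lt (Nat.mul_le_mul_left 2 Finset.card_image_le) ?_
      rwa [Finset.card_powersetCard, Finset.card_univ, Fintype.card_fin])
  refine ⟨fun x y ↦ decide (s(x, y) ∈ A), fun x y ↦ by simp only [Sym2.eq_swap], fun S hS ↦ ?_⟩
  obtain ⟨hsub, hdisj⟩ := hA (edges S) (Finset.mem_image_of_mem edges
    (Finset.mem_powersetCard.2 ⟨Finset.subset_univ S, hS⟩))
  constructor
  · obtain ⟨e, heA, he⟩ := Finset.not_disjoint_iff.1 hdisj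
    obtain ⟨⟨x, y⟩, hxy, rfl⟩ := Finset.mem_image.1 he
    obtain ⟨hx, hy, hne⟩ := Finset.mem_offDiag.1 hxy
    exact ⟨x, hx, y, hy, hne, decide_eq_true heA⟩
  · obtain ⟨e, he, heA⟩ := Finset.not_subset.1 hsub
    obtain ⟨⟨x, y⟩, hxy, rfl⟩ := Finset.mem_image.1 he
    obtain ⟨hx, hy, hne⟩ := Finset.mem_offDiag.1 hxy
    exact ⟨x, hx, y, hy, hne, decide_eq_false heA⟩
end

section
/- (Hardy–Ramanujan / Erdős–Kac concentration) Let ν(x) denote the number of distinct prime divisors of the positive integer x. Then for any function ω : ℕ → ℝ with ω(n) → ∞ as n → ∞, the number of integers x ∈ {1, …, n} satisfying |ν(x) − ln(ln n)| > ω(n)·√(ln(ln n)) is o(n); that is, (1/n)·#{x ≤ n : |ν(x) − ln(ln n)| > ω(n)·√(ln(ln n))} → 0 as n → ∞. -/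
open Filter

lemma log_factorial_eq_sum_primesLE (n : ℕ) :
    Real.log n.factorial =
      ∑ p ∈ n.primesLE, (n.factorial.factorization p : ℝ) * Real.log p := by
  rw [Real.log_nat_eq_sum_factorization]
  refine Finsupp.sum_of_support_subset _ (fun p hp => ?_) _ (by simp)
  rw [Nat.support_factorization, Nat.mem_primeFactors] at hp
  exact Nat.mem_primesLE.2 ⟨(hp.1.dvd_factorial).1 hp.2.1, hp.1⟩

lemma sum_log_div_primesLE_le {n : ℕ} (hn : 0 < n) :
    ∑ p ∈ n.primesLE, Real.log p / p ≤ Real.log n + Real.log 4 := by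
  have hn' : (0 : ℝ) < n := by exact_mod_cast hn
  have hterm : ∀ p ∈ n.primesLE, n * (Real.log p / p) ≤
      n.factorial.factorization p * Real.log p + Real.log p := by
    intro p hp
    have hpp := Nat.prime_of_mem_primesLE hp
    have hple := Nat.le_of_mem_primesLE hp
    have hdiv : n / p ≤ n.factorial.factorization p := by
      rw [Nat.factorization_factorial hpp (Nat.lt_succ_self _)]
      have hmem : 1 ∈ Finset.Ico 1 (Nat.log p n).succ := by
        have := Nat.log_pos hpp.one_lt hple
        exact Finset.mem_Ico.2 ⟨le_rfl, by omega⟩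
      simpa using Finset.single_le_sum (f := fun i => n / p ^ i) (fun _ _ => Nat.zero_le _) hmem
    have hfl : (n : ℝ) / p ≤ n.factorial.factorization p + 1 := by
      have h1 : (n : ℝ) / p < (n / p : ℕ) + 1 := by
        rw [← Nat.floor_div_eq_div (K := ℝ)]
        exact Nat.lt_floor_add_one _
      have h2 : ((n / p : ℕ) : ℝ) ≤ n.factorial.factorization p := by exact_mod_cast hdiv
      linarith
    have hlog : 0 ≤ Real.log p := Real.log_natCast_nonneg p
    calc n * (Real.log p / p) = n / p * Real.log p := by ring
      _ ≤ (n.factorial.factorization p + 1) * Real.log p := by gcongr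
      _ = _ := by ring
  have hsum := Finset.sum_le_sum hterm
  rw [← Finset.mul_sum, Finset.sum_add_distrib, ← log_factorial_eq_sum_primesLE,
    ← Chebyshev.theta_eq_sum_primesLE_log] at hsum
  have hθ := Chebyshev.theta_le_log4_mul_x hn'.le
  have hfact : Real.log n.factorial ≤ n * Real.log n := by
    rw [← Real.log_pow]
    exact Real.log_le_log (by positivity) (by exact_mod_cast Nat.factorial_le_pow n)
  refine le_of_mul_le_mul_left ?_ hn'
  linarith

lemma summable_log_div_mul_sub_one :
    Summable fun m : ℕ => Real.log m / (m * (m - 1)) := by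
  have h : Summable fun m : ℕ => 4 * ((m : ℝ) ^ (3 / 2 : ℝ))⁻¹ :=
    (Real.summable_nat_rpow_inv.2 (by norm_num)).mul_left 4
  refine Summable.of_norm_bounded h fun m => ?_
  rcases Nat.lt_or_ge m 2 with hm | hm
  · interval_cases m <;> simp
  have hm' : (2 : ℝ) ≤ m := by exact_mod_cast hm
  have hlog0 : 0 ≤ Real.log m := Real.log_natCast_nonneg m
  have hlog : Real.log m ≤ (m : ℝ) ^ (1 / 2 : ℝ) / (1 / 2) :=
    Real.log_le_rpow_div (by linarith) (by norm_num)
  rw [Real.norm_of_nonneg (div_nonneg hlog0 (mul_nonneg (by linarith) (by linarith))),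
    ← div_eq_mul_inv, div_le_div_iff₀ (by nlinarith) (by positivity)]
  have hpow : (m : ℝ) ^ (1 / 2 : ℝ) * (m : ℝ) ^ (3 / 2 : ℝ) = m * m := by
    rw [← Real.rpow_add (by linarith), ← sq, ← Real.rpow_natCast]
    norm_num
  calc Real.log m * (m : ℝ) ^ (3 / 2 : ℝ)
      ≤ (m : ℝ) ^ (1 / 2 : ℝ) / (1 / 2) * (m : ℝ) ^ (3 / 2 : ℝ) := by gcongr
    _ = 2 * ((m : ℝ) ^ (1 / 2 : ℝ) * (m : ℝ) ^ (3 / 2 : ℝ)) := by ring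
    _ = 2 * (m * m) := by rw [hpow]
    _ ≤ 4 * (m * (m - 1)) := by nlinarith

lemma log_le_sum_log_div_primesLE {n : ℕ} (hn : 0 < n) :
    Real.log n - 1 - ∑' m : ℕ, Real.log m / (m * (m - 1)) ≤
      ∑ p ∈ n.primesLE, Real.log p / p := by
  have hn' : (0 : ℝ) < n := by exact_mod_cast hn
  have hterm : ∀ p ∈ n.primesLE, n.factorial.factorization p * Real.log p ≤
      n * (Real.log p / p + Real.log p / (p * (p - 1))) := by
    intro p hp
    have hpp := Nat.prime_of_mem_primesLE hp
    have hp1 : (1 : ℝ) < p := by exact_mod_cast hpp.one_lt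
    have hp0 : (p : ℝ) - 1 ≠ 0 := by linarith
    have hp0' : (p : ℝ) ≠ 0 := by linarith
    have hle : (n.factorial.factorization p : ℝ) ≤ n / (p - 1) := by
      refine (Nat.cast_le.2 (Nat.factorization_factorial_le_div_pred hpp n)).trans ?_
      refine Nat.cast_div_le.trans ?_
      rw [Nat.cast_sub hpp.one_le, Nat.cast_one]
    calc n.factorial.factorization p * Real.log p ≤ n / (p - 1) * Real.log p :=
          mul_le_mul_of_nonneg_right hle (Real.log_natCast_nonneg p)
      _ = _ := by field_simp; ring
  have hsum := Finset.sum_le_sum hterm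
  rw [← Finset.mul_sum, Finset.sum_add_distrib, ← log_factorial_eq_sum_primesLE] at hsum
  have htail : ∑ p ∈ n.primesLE, Real.log p / (p * (p - 1)) ≤
      ∑' m : ℕ, Real.log m / (m * (m - 1)) := by
    refine summable_log_div_mul_sub_one.sum_le_tsum _ fun m _ => ?_
    rcases Nat.eq_zero_or_pos m with rfl | hm
    · simp
    have : (1 : ℝ) ≤ m := by exact_mod_cast hm
    exact div_nonneg (Real.log_natCast_nonneg m) (mul_nonneg (by linarith) (by linarith))
  have hfact : n * Real.log n - n ≤ Real.log n.factorial := by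
    have h := Real.log_le_log (by positivity) (Real.pow_div_factorial_le_exp (n : ℝ) hn'.le n)
    rw [Real.log_exp, Real.log_div (by positivity) (by positivity), Real.log_pow] at h
    linarith
  have := mul_le_mul_of_nonneg_left htail hn'.le
  refine le_of_mul_le_mul_left ?_ hn'
  linarith

/-- **Mertens' first theorem**. -/
lemma exists_abs_sum_log_div_primesLE_sub_log_le :
    ∃ C : ℝ, 0 ≤ C ∧ ∀ n : ℕ, 0 < n →
      |∑ p ∈ n.primesLE, Real.log p / p - Real.log n| ≤ C := by
  refine ⟨max (Real.log 4) (1 + ∑' m : ℕ, Real.log m / (m * (m - 1))),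
    le_max_of_le_left (Real.log_nonneg (by norm_num)), fun n hn => abs_le.2 ⟨?_, ?_⟩⟩
  · have := log_le_sum_log_div_primesLE hn
    have := le_max_right (Real.log 4) (1 + ∑' m : ℕ, Real.log m / (m * (m - 1)))
    linarith
  · have := sum_log_div_primesLE_le hn
    have := le_max_left (Real.log 4) (1 + ∑' m : ℕ, Real.log m / (m * (m - 1)))
    linarith

lemma abs_sub_div_sub_log_sub_log_le {u v : ℝ} (hu : 0 < u) (huv : u ≤ v) :
    |(v - u) / v - (Real.log v - Real.log u)| ≤ (v - u) * (1 / u - 1 / v) := by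
  have hv : 0 < v := hu.trans_le huv
  have hup : Real.log v - Real.log u ≤ (v - u) / u := by
    rw [← Real.log_div hv.ne' hu.ne', sub_div, div_self hu.ne']
    exact Real.log_le_sub_one_of_pos (by positivity)
  have hlow : (v - u) / v ≤ Real.log v - Real.log u := by
    have := Real.log_le_sub_one_of_pos (div_pos hu hv)
    rw [Real.log_div hu.ne' hv.ne'] at this
    rw [sub_div, div_self hv.ne']
    linarith
  have : (v - u) * (1 / u - 1 / v) = (v - u) / u - (v - u) / v := by ring
  rw [abs_le]
  constructor <;> linarith

/-- **Mertens' second theorem**, without identifying the limiting constant. -/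
lemma exists_abs_sum_inv_primesLE_sub_log_log_le :
    ∃ K : ℝ, 0 ≤ K ∧ ∀ n : ℕ, 2 ≤ n →
      |∑ p ∈ n.primesLE, (1 : ℝ) / p - Real.log (Real.log n)| ≤ K := by
  obtain ⟨C, hC, hA⟩ := exists_abs_sum_log_div_primesLE_sub_log_le
  set A : ℕ → ℝ := fun n => ∑ p ∈ n.primesLE, Real.log p / p with hAdef
  set S : ℕ → ℝ := fun n => ∑ p ∈ n.primesLE, (1 : ℝ) / p with hSdef
  set E : ℕ → ℝ := fun n => S n - Real.log (Real.log n) - (A n - Real.log n) / Real.log n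
    with hEdef
  have hlog2 : 0 < Real.log 2 := Real.log_pos (by norm_num)
  have hlogle : ∀ n : ℕ, 2 ≤ n → Real.log 2 ≤ Real.log n := fun n hn =>
    Real.log_le_log (by norm_num) (by exact_mod_cast hn)
  have hstep : ∀ n : ℕ, 2 ≤ n →
      |E (n + 1) - E n| ≤ (C + 1) * (1 / Real.log n - 1 / Real.log (n + 1 : ℕ)) := by
    intro n hn
    have hn' : (2 : ℝ) ≤ n := by exact_mod_cast hn
    set u := Real.log n with hu
    set v := Real.log (n + 1 : ℕ) with hv
    have hu0 : 0 < u := hlog2.trans_le (hlogle n hn)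
    have huv : u ≤ v := Real.log_le_log (by linarith) (by push_cast; linarith)
    have hv0 : 0 < v := hu0.trans_le huv
    have hvu : v - u ≤ 1 := by
      rw [hu, hv, ← Real.log_div (by positivity) (by positivity)]
      refine (Real.log_le_sub_one_of_pos (by positivity)).trans ?_
      rw [sub_le_iff_le_add, div_le_iff₀ (by linarith)]
      push_cast; linarith
    have hSA : S (n + 1) - S n = (A (n + 1) - A n) / v := by
      simp only [hSdef, hAdef, Nat.primesLE_succ]
      split_ifs with h
      · rw [Finset.sum_insert (Nat.notMem_primesLE n), Finset.sum_insert (Nat.notMem_primesLE n)]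
        field_simp
        ring
      · simp
    have hkey : E (n + 1) - E n = (A n - u) * (1 / u - 1 / v) +
        ((v - u) / v - (Real.log v - Real.log u)) := by
      have : E (n + 1) - E n = (S (n + 1) - S n) - (Real.log v - Real.log u) -
          ((A (n + 1) - v) / v - (A n - u) / u) := by
        simp only [hEdef, ← hu, ← hv]; ring
      rw [this, hSA]
      field_simp
      ring
    have hd : 0 ≤ 1 / u - 1 / v := sub_nonneg.2 (one_div_le_one_div_of_le hu0 huv)
    rw [hkey]
    calc _ ≤ |(A n - u) * (1 / u - 1 / v)| + |(v - u) / v - (Real.log v - Real.log u)| :=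
          abs_add_le _ _
      _ ≤ C * (1 / u - 1 / v) + (v - u) * (1 / u - 1 / v) := by
          rw [abs_mul, abs_of_nonneg hd]
          exact add_le_add (mul_le_mul_of_nonneg_right (hA n (by omega)) hd)
            (abs_sub_div_sub_log_sub_log_le hu0 huv)
      _ ≤ C * (1 / u - 1 / v) + 1 * (1 / u - 1 / v) := by gcongr
      _ = _ := by ring
  have hE : ∀ n : ℕ, 2 ≤ n →
      |E n| ≤ |E 2| + (C + 1) * (1 / Real.log 2 - 1 / Real.log n) := by
    intro n hn
    induction n, hn using Nat.le_induction with
    | base => simp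
    | succ n hn ih =>
      have h1 := hstep n hn
      have h2 := abs_add_le (E n) (E (n + 1) - E n)
      rw [add_sub_cancel] at h2
      linarith
  refine ⟨|E 2| + (C + 1) / Real.log 2 + C / Real.log 2, by positivity, fun n hn => ?_⟩
  have hln := hlogle n hn
  have hln0 := hlog2.trans_le hln
  have h1 : |(A n - Real.log n) / Real.log n| ≤ C / Real.log 2 := by
    rw [abs_div, abs_of_pos hln0]
    exact div_le_div₀ hC (hA n (by omega)) hlog2 hln
  have h2 : (C + 1) * (1 / Real.log 2 - 1 / Real.log n) ≤ (C + 1) / Real.log 2 := by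
    rw [div_eq_mul_one_div (C + 1)]
    exact mul_le_mul_of_nonneg_left (sub_le_self _ (one_div_nonneg.2 hln0.le)) (by linarith)
  have h3 := abs_add_le (E n) ((A n - Real.log n) / Real.log n)
  have h4 : E n + (A n - Real.log n) / Real.log n = S n - Real.log (Real.log n) := by
    simp only [hEdef]; ring
  rw [h4] at h3
  linarith [hE n hn]

lemma card_filter_dvd_le (n d : ℕ) :
    (((Finset.Icc 1 n).filter (d ∣ ·)).card : ℝ) ≤ n / d := by
  have h := Nat.Ioc_filter_dvd_card_eq_div n d
  have hI : Finset.Icc 1 n = Finset.Ioc 0 n := by ext; simp; omega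
  rw [hI, h]
  exact Nat.cast_div_le

lemma card_primeFactors_eq_sum {n x : ℕ} (hx : x ∈ Finset.Icc 1 n) :
    (x.primeFactors.card : ℝ) = ∑ p ∈ n.primesLE, if p ∣ x then 1 else 0 := by
  rw [Finset.mem_Icc] at hx
  rw [Finset.sum_boole]
  congr 2
  ext p
  simp only [Nat.mem_primeFactors, Finset.mem_filter, Nat.mem_primesLE]
  constructor
  · rintro ⟨hp, hd, -⟩
    exact ⟨⟨(Nat.le_of_dvd hx.1 hd).trans hx.2, hp⟩, hd⟩
  · rintro ⟨⟨-, hp⟩, hd⟩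
    exact ⟨hp, hd, by omega⟩

lemma le_sum_card_primeFactors (n : ℕ) :
    n * ∑ p ∈ n.primesLE, (1 : ℝ) / p - n ≤
      ∑ x ∈ Finset.Icc 1 n, (x.primeFactors.card : ℝ) := by
  rw [Finset.sum_congr rfl fun x hx => card_primeFactors_eq_sum hx, Finset.sum_comm]
  have hterm : ∀ p ∈ n.primesLE, n * ((1 : ℝ) / p) - 1 ≤
      ∑ x ∈ Finset.Icc 1 n, if p ∣ x then (1 : ℝ) else 0 := by
    intro p hp
    have hI : Finset.Icc 1 n = Finset.Ioc 0 n := by ext; simp; omega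
    rw [Finset.sum_boole, hI, Nat.Ioc_filter_dvd_card_eq_div, ← Nat.floor_div_eq_div (K := ℝ)]
    have := Nat.lt_floor_add_one ((n : ℝ) / p)
    rw [mul_one_div]
    linarith
  refine le_trans ?_ (Finset.sum_le_sum hterm)
  rw [Finset.sum_sub_distrib, ← Finset.mul_sum]
  have hcard : n.primesLE.card ≤ n := by
    rw [Nat.primesLE_eq_filter_Icc_one]
    exact (Finset.card_filter_le _ _).trans (by simp)
  have : (n.primesLE.card : ℝ) ≤ n := by exact_mod_cast hcard
  rw [Finset.sum_const, nsmul_one]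
  linarith

lemma sum_sq_card_primeFactors_le (n : ℕ) :
    ∑ x ∈ Finset.Icc 1 n, (x.primeFactors.card : ℝ) ^ 2 ≤
      n * (∑ p ∈ n.primesLE, (1 : ℝ) / p) ^ 2 + n * ∑ p ∈ n.primesLE, (1 : ℝ) / p := by
  have hsq : ∀ x ∈ Finset.Icc 1 n, (x.primeFactors.card : ℝ) ^ 2 =
      ∑ p ∈ n.primesLE, ∑ q ∈ n.primesLE, if p ∣ x ∧ q ∣ x then 1 else 0 := by
    intro x hx
    rw [card_primeFactors_eq_sum hx, sq, Finset.sum_mul_sum]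
    refine Finset.sum_congr rfl fun p _ => Finset.sum_congr rfl fun q _ => ?_
    by_cases hp : p ∣ x <;> by_cases hq : q ∣ x <;> simp [hp, hq]
  have hpair : ∀ p ∈ n.primesLE, ∀ q ∈ n.primesLE,
      (∑ x ∈ Finset.Icc 1 n, if p ∣ x ∧ q ∣ x then (1 : ℝ) else 0) ≤
        n * (1 / p * (1 / q)) + if p = q then n * (1 / (p : ℝ)) else 0 := by
    intro p hp q hq
    rw [Finset.sum_boole]
    split_ifs with h
    · subst h
      have := card_filter_dvd_le n p
      simp only [and_self]
      have h0 : (0 : ℝ) ≤ n * (1 / p * (1 / p)) := by positivity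
      have h1 : (n : ℝ) * (1 / p) = n / p := mul_one_div _ _
      linarith
    · have hcop : Nat.Coprime p q :=
        (Nat.coprime_primes (Nat.prime_of_mem_primesLE hp) (Nat.prime_of_mem_primesLE hq)).2 h
      have hfil : (Finset.Icc 1 n).filter (fun x => p ∣ x ∧ q ∣ x) =
          (Finset.Icc 1 n).filter (p * q ∣ ·) :=
        Finset.filter_congr fun x _ =>
          ⟨fun hx => hcop.mul_dvd_of_dvd_of_dvd hx.1 hx.2,
            fun hx => ⟨dvd_of_mul_right_dvd hx, dvd_of_mul_left_dvd hx⟩⟩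
      rw [hfil]
      refine (card_filter_dvd_le n (p * q)).trans (le_of_eq ?_)
      push_cast
      rw [add_zero, one_div_mul_one_div, mul_one_div]
  rw [Finset.sum_congr rfl hsq, Finset.sum_comm]
  simp_rw [Finset.sum_comm (s := Finset.Icc 1 n)]
  refine (Finset.sum_le_sum fun p hp => Finset.sum_le_sum (hpair p hp)).trans (le_of_eq ?_)
  simp_rw [Finset.sum_add_distrib, ← Finset.mul_sum]
  rw [← Finset.sum_mul, ← sq]
  congr 1
  rw [Finset.mul_sum]
  exact Finset.sum_congr rfl fun p hp => by rw [Finset.sum_ite_eq, if_pos hp]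

/-- The **Turán inequality**, centred at the sum of the reciprocals of the primes. -/
lemma sum_sq_card_primeFactors_sub_le (n : ℕ) :
    ∑ x ∈ Finset.Icc 1 n, ((x.primeFactors.card : ℝ) - ∑ p ∈ n.primesLE, (1 : ℝ) / p) ^ 2 ≤
      3 * n * ∑ p ∈ n.primesLE, (1 : ℝ) / p := by
  have h1 := le_sum_card_primeFactors n
  have h2 := sum_sq_card_primeFactors_le n
  have hS : 0 ≤ ∑ p ∈ n.primesLE, (1 : ℝ) / p := Finset.sum_nonneg fun _ _ => by positivity
  set S := ∑ p ∈ n.primesLE, (1 : ℝ) / p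
  have hexp : ∑ x ∈ Finset.Icc 1 n, ((x.primeFactors.card : ℝ) - S) ^ 2 =
      ∑ x ∈ Finset.Icc 1 n, (x.primeFactors.card : ℝ) ^ 2 -
        2 * S * ∑ x ∈ Finset.Icc 1 n, (x.primeFactors.card : ℝ) + n * S ^ 2 := by
    rw [Finset.mul_sum, ← Finset.sum_sub_distrib]
    have : (n : ℝ) * S ^ 2 = ∑ _x ∈ Finset.Icc 1 n, S ^ 2 := by simp
    rw [this, ← Finset.sum_add_distrib]
    exact Finset.sum_congr rfl fun x _ => by ring
  have h3 := mul_le_mul_of_nonneg_left h1 hS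
  rw [hexp]
  nlinarith

/-- The **Turán inequality**, centred at `log (log n)`. -/
lemma exists_sum_sq_card_primeFactors_sub_log_log_le :
    ∃ C : ℝ, ∀ n : ℕ, 2 ≤ n → 1 ≤ Real.log (Real.log n) →
      ∑ x ∈ Finset.Icc 1 n, ((x.primeFactors.card : ℝ) - Real.log (Real.log n)) ^ 2 ≤
        C * n * Real.log (Real.log n) := by
  obtain ⟨K, hK, hS⟩ := exists_abs_sum_inv_primesLE_sub_log_log_le
  refine ⟨6 + 6 * K + 2 * K ^ 2, fun n hn hL => ?_⟩
  have hT := sum_sq_card_primeFactors_sub_le n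
  have hSn := hS n hn
  set S := ∑ p ∈ n.primesLE, (1 : ℝ) / p
  set L := Real.log (Real.log n)
  have hsq : (S - L) ^ 2 ≤ K ^ 2 := sq_le_sq' (abs_le.1 hSn).1 (abs_le.1 hSn).2
  have hSL : S ≤ L + K := by linarith [(abs_le.1 hSn).2]
  calc ∑ x ∈ Finset.Icc 1 n, ((x.primeFactors.card : ℝ) - L) ^ 2
      ≤ ∑ x ∈ Finset.Icc 1 n, (2 * ((x.primeFactors.card : ℝ) - S) ^ 2 + 2 * K ^ 2) :=
        Finset.sum_le_sum fun x _ => by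
          nlinarith [sq_nonneg ((x.primeFactors.card : ℝ) - S - (S - L))]
    _ = 2 * ∑ x ∈ Finset.Icc 1 n, ((x.primeFactors.card : ℝ) - S) ^ 2 + n * (2 * K ^ 2) := by
        rw [Finset.sum_add_distrib, ← Finset.mul_sum]; simp
    _ ≤ 2 * (3 * n * (L + K)) + n * (2 * K ^ 2) := by
        have : 3 * (n : ℝ) * S ≤ 3 * n * (L + K) := by gcongr
        linarith
    _ = n * (6 * L + 6 * K + 2 * K ^ 2) := by ring
    _ ≤ n * (6 * L + 6 * K * L + 2 * K ^ 2 * L) := by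
        have h1 : 6 * K ≤ 6 * K * L := le_mul_of_one_le_right (by positivity) hL
        have h2 : 2 * K ^ 2 ≤ 2 * K ^ 2 * L := le_mul_of_one_le_right (by positivity) hL
        gcongr
    _ = _ := by ring

/-- **Chebyshev's inequality** for the counting measure on a finite set. -/
lemma card_filter_lt_abs_mul_sq_le {ι : Type*} (s : Finset ι) (f : ι → ℝ) {t : ℝ} (ht : 0 ≤ t)
    [DecidablePred fun x => t < |f x|] :
    ((s.filter fun x => t < |f x|).card : ℝ) * t ^ 2 ≤ ∑ x ∈ s, f x ^ 2 := by
  rw [← nsmul_eq_mul]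
  refine (Finset.card_nsmul_le_sum _ (fun x => f x ^ 2) _ fun x hx => ?_).trans
    (Finset.sum_le_sum_of_subset_of_nonneg (Finset.filter_subset _ _) fun _ _ _ => sq_nonneg _)
  rw [← sq_abs (f x)]
  exact pow_le_pow_left₀ ht (Finset.mem_filter.1 hx).2.le 2

open scoped Classical in
/-- **Hardy–Ramanujan concentration of the number of prime divisors.** Let `ν(x)` be the
number of distinct prime divisors of `x`. For any `ω : ℕ → ℝ` tending to infinity, the
proportion of `x ∈ {1, …, n}` with `|ν(x) - ln ln n| > ω(n)·√(ln ln n)` tends to `0`. -/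
theorem hardy_ramanujan_concentration (ω : ℕ → ℝ) (hω : Tendsto ω atTop atTop) :
    Tendsto (fun n : ℕ =>
        (((Finset.Icc 1 n).filter (fun x =>
            ω n * Real.sqrt (Real.log (Real.log n)) <
              |(x.primeFactors.card : ℝ) - Real.log (Real.log n)|)).card : ℝ) / n)
      atTop (nhds 0) := by
  obtain ⟨C, hC⟩ := exists_sum_sq_card_primeFactors_sub_log_log_le
  have hlim : Tendsto (fun n => C / ω n ^ 2) atTop (nhds 0) :=
    Tendsto.const_div_atTop ((tendsto_pow_atTop two_ne_zero).comp hω) C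
  have hL : Tendsto (fun n : ℕ => Real.log (Real.log n)) atTop atTop :=
    Real.tendsto_log_atTop.comp (Real.tendsto_log_atTop.comp tendsto_natCast_atTop_atTop)
  refine squeeze_zero' (Eventually.of_forall fun n => by positivity) ?_ hlim
  filter_upwards [hω.eventually_gt_atTop 0, hL.eventually_ge_atTop 1, eventually_ge_atTop 2]
    with n hωn hLn hn
  have hn0 : (0 : ℝ) < n := by exact_mod_cast (by omega : 0 < n)
  have hL0 : 0 < Real.log (Real.log n) := by linarith
  have hcheb := (card_filter_lt_abs_mul_sq_le (Finset.Icc 1 n)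
    (fun x => (x.primeFactors.card : ℝ) - Real.log (Real.log n))
    (mul_nonneg hωn.le (Real.sqrt_nonneg (Real.log (Real.log n))))).trans (hC n hn hLn)
  rw [mul_pow, Real.sq_sqrt hL0.le, ← mul_assoc] at hcheb
  rw [div_le_div_iff₀ hn0 (by positivity)]
  exact le_of_mul_le_mul_right hcheb hL0
end
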